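/- arXiv:2105.04999 — 3 statements merged into one kernel-verified Lean document; each statement's English description precedes it below -/
import Mathlib

section
/- Let A ∈ ℝ^{q×q} be strictly lower triangular, b ∈ ℝ^q, let R be the stability function of the scheme, and let 1 ≤ p ≤ q. If bᵀ A^{k−1} 𝟙 = 1/k! for every k with 1 ≤ k ≤ p, then R(x) − e^x = O(x^{p+1}) as x → 0 over the reals; that is, matching the first p Taylor coefficients of the exponential yields a scheme of order p on the linear test equation. -/
open Matrix BigOperators Asymptotics

/-- Stability function `R(x) = 1 + x bᵀ (I − x A)⁻¹ 𝟙` of an explicit Runge–Kutta scheme,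
as a real function of a real argument. -/
noncomputable def stabilityFunctionReal {q : ℕ} (A : Matrix (Fin q) (Fin q) ℝ)
    (b : Fin q → ℝ) (x : ℝ) : ℝ :=
  1 + x * (b ⬝ᵥ (((1 : Matrix (Fin q) (Fin q) ℝ) - x • A)⁻¹ *ᵥ fun _ => (1 : ℝ)))

/-- The entries of the `k`-th power of a strictly lower triangular matrix vanish above the `k`-th
subdiagonal. -/
theorem Matrix.pow_apply_eq_zero_of_strictly_lower {R : Type*} [Semiring R] {q : ℕ}
    {A : Matrix (Fin q) (Fin q) R} (hA : ∀ i j : Fin q, i ≤ j → A i j = 0) (k : ℕ)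
    (i j : Fin q) (hij : (i : ℕ) < j + k) : (A ^ k) i j = 0 := by
  induction k generalizing i j with
  | zero => simp [Matrix.one_apply_ne (Fin.ne_of_lt hij)]
  | succ k ih =>
    rw [pow_succ, Matrix.mul_apply]
    refine Finset.sum_eq_zero fun l _ => ?_
    by_cases hl : l ≤ j
    · rw [hA l j hl, mul_zero]
    · rw [ih i l (by rw [Fin.le_def] at hl; omega), zero_mul]

/-- A strictly lower triangular matrix is nilpotent. -/
theorem Matrix.pow_eq_zero_of_strictly_lower {R : Type*} [Semiring R] {q : ℕ}
    {A : Matrix (Fin q) (Fin q) R} (hA : ∀ i j : Fin q, i ≤ j → A i j = 0) : A ^ q = 0 := by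
  ext i j
  exact pow_apply_eq_zero_of_strictly_lower hA q i j (by omega)

/-- The stability function of an explicit scheme is a polynomial. -/
theorem stabilityFunctionReal_eq_sum {q : ℕ} {A : Matrix (Fin q) (Fin q) ℝ}
    (hA : ∀ i j : Fin q, i ≤ j → A i j = 0) (b : Fin q → ℝ) (x : ℝ) :
    stabilityFunctionReal A b x =
      1 + ∑ k ∈ Finset.range q, (b ⬝ᵥ ((A ^ k) *ᵥ fun _ => (1 : ℝ))) * x ^ (k + 1) := by
  have hinv : ((1 : Matrix (Fin q) (Fin q) ℝ) - x • A)⁻¹ =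
      ∑ k ∈ Finset.range q, (x • A) ^ k := by
    apply Matrix.inv_eq_right_inv
    rw [mul_neg_geom_sum, smul_pow, Matrix.pow_eq_zero_of_strictly_lower hA, smul_zero, sub_zero]
  rw [stabilityFunctionReal, hinv, Matrix.sum_mulVec, dotProduct_sum, Finset.mul_sum]
  congr 1
  refine Finset.sum_congr rfl fun k _ => ?_
  rw [smul_pow, Matrix.smul_mulVec, dotProduct_smul, smul_eq_mul]
  ring

/-- If the Runge–Kutta coefficients satisfy `bᵀ A^{k−1} 𝟙 = 1/k!` for `1 ≤ k ≤ p`,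
then `R(x) − e^x = O(x^{p+1})` as `x → 0`: the scheme has order `p` on the linear test
equation. -/
theorem rk_order_p_from_taylor_matching (q : ℕ) (A : Matrix (Fin q) (Fin q) ℝ)
    (hA : ∀ i j : Fin q, i ≤ j → A i j = 0) (b : Fin q → ℝ)
    (p : ℕ) (hp1 : 1 ≤ p) (hpq : p ≤ q)
    (hmatch : ∀ k : ℕ, 1 ≤ k → k ≤ p →
      b ⬝ᵥ ((A ^ (k - 1)) *ᵥ fun _ => (1 : ℝ)) = 1 / (Nat.factorial k : ℝ)) :
    (fun x : ℝ => stabilityFunctionReal A b x - Real.exp x) =O[nhds 0]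
      fun x : ℝ => x ^ (p + 1) := by
  have htaylor : ∀ x : ℝ, stabilityFunctionReal A b x =
      ∑ k ∈ Finset.range (p + 1), x ^ k / (Nat.factorial k : ℝ) +
        ∑ k ∈ Finset.Ico p q, (b ⬝ᵥ ((A ^ k) *ᵥ fun _ => (1 : ℝ))) * x ^ (k + 1) := by
    intro x
    rw [stabilityFunctionReal_eq_sum hA, ← Finset.sum_range_add_sum_Ico _ hpq, ← add_assoc,
      Finset.sum_range_succ', pow_zero, Nat.factorial_zero, Nat.cast_one, div_one, add_comm 1]
    congr 2
    refine Finset.sum_congr rfl fun k hk => ?_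
    have h := hmatch (k + 1) (by omega) (by have := Finset.mem_range.mp hk; omega)
    rw [Nat.add_sub_cancel] at h
    rw [h]
    ring
  have htail : (fun x : ℝ => ∑ k ∈ Finset.Ico p q,
      (b ⬝ᵥ ((A ^ k) *ᵥ fun _ => (1 : ℝ))) * x ^ (k + 1)) =O[nhds 0]
        fun x : ℝ => x ^ (p + 1) := by
    refine IsBigO.fun_sum fun k hk => ?_
    refine IsBigO.const_mul_left ?_ (b ⬝ᵥ ((A ^ k) *ᵥ fun _ => (1 : ℝ)))
    rcases (Finset.mem_Ico.mp hk).1.eq_or_lt with rfl | hlt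
    · exact isBigO_refl _ _
    · exact (isLittleO_pow_pow (Nat.succ_lt_succ hlt)).isBigO
  refine (htail.sub (Real.exp_sub_sum_range_isBigO_pow (p + 1))).congr_left fun x => ?_
  rw [htaylor]
  ring
end

section
/- Let q ≥ 1, let R be a real polynomial with deg R ≤ q, R(0) = 1 and R'(0) = 1 (a consistent stability polynomial), and let β > 0 be such that |R(x)| ≤ 1 for all real x ∈ [−β, 0]. Then β ≤ 2q². That is, the real-axis stability interval of a consistent q-stage explicit Runge–Kutta scheme has length at most 2q². -/
open Set

/-- The real-axis stability interval of a consistent `q`-stage explicit Runge–Kutta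
scheme has length at most `2q²`: if `R` is a real polynomial of degree at most `q` with
`R(0) = 1`, `R'(0) = 1` and `|R(x)| ≤ 1` on `[−β, 0]` with `β > 0`, then `β ≤ 2q²`. -/
theorem real_axis_stability_bound (q : ℕ) (hq : 1 ≤ q) (R : Polynomial ℝ)
    (hdeg : R.natDegree ≤ q) (h0 : R.eval 0 = 1) (h1 : R.derivative.eval 0 = 1)
    (β : ℝ) (hβ : 0 < β) (hstab : ∀ x ∈ Icc (-β) (0 : ℝ), |R.eval x| ≤ 1) :
    β ≤ 2 * (q : ℝ) ^ 2 := by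
  set L : Polynomial ℝ := Polynomial.C (β / 2) * (Polynomial.X - 1) with hL
  have hLdeg : L.natDegree ≤ 1 := by rw [hL]; compute_degree
  have hdegP : (R.comp L).degree ≤ q := by
    refine Polynomial.natDegree_le_iff_degree_le.mp (Polynomial.natDegree_comp_le.trans ?_)
    nlinarith
  have hbound : ∀ x ∈ Icc (-1 : ℝ) 1, |(R.comp L).eval x| ≤ 1 := by
    rintro x ⟨hx₁, hx₂⟩
    rw [Polynomial.eval_comp]
    apply hstab
    constructor <;> simp [hL] <;> nlinarith
  have key := Polynomial.Chebyshev.eval_iterate_derivative_le_of_forall_abs_le_one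
    (n := q) (P := R.comp L) (k := 1) (x := 1) le_rfl hdegP hbound
  simp [Polynomial.derivative_comp, hL, h1, Polynomial.Chebyshev.derivative_T_eval_one] at key
  nlinarith
end

section
/- For every integer q ≥ 1, the polynomial R(x) = T_q(1 + x/q²), where T_q is the degree-q Chebyshev polynomial of the first kind, satisfies R(0) = 1, R'(0) = 1, deg R ≤ q, and |R(x)| ≤ 1 for all real x ∈ [−2q², 0]. Hence the real-axis stability bound 2q² for consistent q-stage schemes is attained. -/
open Set Polynomial

/-- The shifted Chebyshev polynomial `R(x) = T_q(1 + x/q²)` is a consistent stability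
polynomial of degree at most `q` that is stable on the whole interval `[−2q², 0]`:
the real-axis stability bound `2q²` is attained. -/
theorem chebyshev_attains_real_axis_bound (q : ℕ) (hq : 1 ≤ q) :
    (((Polynomial.Chebyshev.T ℝ q).comp
        (1 + Polynomial.C (1 / (q : ℝ) ^ 2) * Polynomial.X)).eval 0 = 1) ∧
    ((Polynomial.derivative ((Polynomial.Chebyshev.T ℝ q).comp
        (1 + Polynomial.C (1 / (q : ℝ) ^ 2) * Polynomial.X))).eval 0 = 1) ∧
    ((Polynomial.Chebyshev.T ℝ q).comp
        (1 + Polynomial.C (1 / (q : ℝ) ^ 2) * Polynomial.X)).natDegree ≤ q ∧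
    (∀ x ∈ Icc (-(2 * (q : ℝ) ^ 2)) (0 : ℝ),
      |(((Polynomial.Chebyshev.T ℝ q).comp
        (1 + Polynomial.C (1 / (q : ℝ) ^ 2) * Polynomial.X)).eval x)| ≤ 1) := by
  have hq0 : (0 : ℝ) < (q : ℝ) ^ 2 := by positivity
  refine ⟨by simp, ?_, ?_, fun x hx => ?_⟩
  · have hT : (derivative (Chebyshev.T ℝ q)).eval 1 = (q : ℝ) ^ 2 := by
      simpa using Chebyshev.derivative_T_eval_one (R := ℝ) q
    rw [derivative_comp]
    simp only [eval_mul, eval_comp, eval_add, eval_one, eval_C, eval_X, mul_zero, add_zero, hT,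
      derivative_add, derivative_one, derivative_C_mul, derivative_X, mul_one, zero_add]
    field_simp
  · refine natDegree_comp_le.trans ?_
    rw [Chebyshev.natDegree_T, Int.natAbs_natCast]
    refine (Nat.mul_le_mul_left q ?_).trans_eq (mul_one q)
    compute_degree
  · rw [eval_comp]
    apply Chebyshev.abs_eval_T_real_le_one
    simp only [eval_mul, eval_add, eval_one, eval_C, eval_X]
    have h : -2 ≤ 1 / (q : ℝ) ^ 2 * x := by
      rw [one_div_mul_eq_div, le_div_iff₀ hq0]
      linarith [hx.1]
    have h' : 1 / (q : ℝ) ^ 2 * x ≤ 0 :=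
      mul_nonpos_of_nonneg_of_nonpos (by positivity) hx.2
    rw [abs_le]
    constructor <;> linarith
end
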